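/- Let 𝒢_Lie be a Lie-closed set of n-qubit Pauli strings, let P, Q ∈ 𝒢_Lie with P anticommuting with Q, and let M be an n-qubit Pauli string that is 𝔤-connected to Q with respect to 𝒢_Lie. Then: (i) if P anticommutes with M and Q commutes with M, there exists R ∈ 𝒢_Lie that commutes with P, anticommutes with Q, and anticommutes with M; (ii) if P commutes with M and Q anticommutes with M, there exists R ∈ 𝒢_Lie that anticommutes with P, commutes with Q, and anticommutes with M; (iii) if P commutes with M and Q commutes with M, there exists R ∈ 𝒢_Lie that anticommutes with each of P, Q, and M. -/

import Mathlib

open Matrix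

noncomputable section

/-- The four single-qubit Pauli matrices: I, X, Y, Z. -/
def pauli1 : Fin 4 → Matrix (Fin 2) (Fin 2) ℂ :=
  ![1, !![0, 1; 1, 0], !![0, -Complex.I; Complex.I, 0], !![1, 0; 0, -1]]

/-- The `n`-qubit Pauli string determined by `f : Fin n → Fin 4`. -/
def PauliString (n : ℕ) (f : Fin n → Fin 4) :
    Matrix (Fin n → Fin 2) (Fin n → Fin 2) ℂ :=
  fun x y => ∏ i, pauli1 (f i) (x i) (y i)

/-- Two matrices commute. -/
def MComm {n : ℕ} (A B : Matrix (Fin n → Fin 2) (Fin n → Fin 2) ℂ) : Prop :=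
  A * B = B * A

/-- Two matrices anticommute. -/
def MAntiComm {n : ℕ} (A B : Matrix (Fin n → Fin 2) (Fin n → Fin 2) ℂ) : Prop :=
  A * B = -(B * A)

/-- A matrix is an `n`-qubit Pauli string. -/
def IsPauli {n : ℕ} (A : Matrix (Fin n → Fin 2) (Fin n → Fin 2) ℂ) : Prop :=
  ∃ f : Fin n → Fin 4, A = PauliString n f

/-- A set of `n`-qubit Pauli strings is Lie-closed: whenever two of its members
anticommute, the (unique) Pauli string appearing, up to a unit scalar, in their
product also belongs to the set. -/
def LieClosed {n : ℕ} (𝒢 : Set (Matrix (Fin n → Fin 2) (Fin n → Fin 2) ℂ)) : Prop :=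
  ∀ P ∈ 𝒢, ∀ Q ∈ 𝒢, MAntiComm P Q →
    ∀ (c : ℂ) (R : Matrix (Fin n → Fin 2) (Fin n → Fin 2) ℂ),
      ‖c‖ = 1 → IsPauli R → P * Q = c • R → R ∈ 𝒢

/-- `P` and `Q` are `𝔤`-connected with respect to `𝒢`: they are distinct and
joined by a chain of anticommutations passing through elements of `𝒢`
(the empty chain meaning that `P` and `Q` themselves anticommute). -/
def GConnected {n : ℕ} (𝒢 : Set (Matrix (Fin n → Fin 2) (Fin n → Fin 2) ℂ))
    (P Q : Matrix (Fin n → Fin 2) (Fin n → Fin 2) ℂ) : Prop :=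
  P ≠ Q ∧ ∃ l : List (Matrix (Fin n → Fin 2) (Fin n → Fin 2) ℂ),
    (∀ R ∈ l, R ∈ 𝒢) ∧ List.Chain' MAntiComm (P :: (l ++ [Q]))

theorem PauliString_mul_apply {n : ℕ} (f g : Fin n → Fin 4) (x y : Fin n → Fin 2) :
    (PauliString n f * PauliString n g) x y = ∏ i, (pauli1 (f i) * pauli1 (g i)) (x i) (y i) := by
  simp only [Matrix.mul_apply, PauliString, ← Finset.prod_mul_distrib]
  rw [Finset.prod_univ_sum, Fintype.piFinset_univ]

theorem PauliString_mul_self {n : ℕ} (f : Fin n → Fin 4) :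
    PauliString n f * PauliString n f = 1 := by
  have h1 : ∀ a, pauli1 a * pauli1 a = 1 := by
    intro a
    fin_cases a <;> ext i j <;> fin_cases i <;> fin_cases j <;> simp [pauli1]
  ext x y
  rw [PauliString_mul_apply]
  simp only [h1, Matrix.one_apply, Finset.prod_ite_zero, Finset.prod_const_one, funext_iff,
    Finset.mem_univ, true_implies]

theorem exists_pauli1_mul (a b : Fin 4) :
    ∃ (c : ℂ) (d : Fin 4), ‖c‖ = 1 ∧ pauli1 a * pauli1 b = c • pauli1 d := by
  fin_cases a <;> fin_cases b
  · exact ⟨1, 0, by simp, by simp [pauli1]⟩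
  · exact ⟨1, 1, by simp, by simp [pauli1]⟩
  · exact ⟨1, 2, by simp, by simp [pauli1]⟩
  · exact ⟨1, 3, by simp, by simp [pauli1]⟩
  · exact ⟨1, 1, by simp, by simp [pauli1]⟩
  · exact ⟨1, 0, by simp, by simp [pauli1, Matrix.one_fin_two]⟩
  · exact ⟨Complex.I, 3, by simp, by simp [pauli1]⟩
  · exact ⟨-Complex.I, 2, by simp, by simp [pauli1]⟩
  · exact ⟨1, 2, by simp, by simp [pauli1]⟩
  · exact ⟨-Complex.I, 3, by simp, by simp [pauli1]⟩
  · exact ⟨1, 0, by simp, by simp [pauli1, Matrix.one_fin_two]⟩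
  · exact ⟨Complex.I, 1, by simp, by simp [pauli1]⟩
  · exact ⟨1, 3, by simp, by simp [pauli1]⟩
  · exact ⟨Complex.I, 2, by simp, by simp [pauli1]⟩
  · exact ⟨-Complex.I, 1, by simp, by simp [pauli1]⟩
  · exact ⟨1, 0, by simp, by simp [pauli1, Matrix.one_fin_two]⟩

theorem exists_pauli1_mul_comm (a b : Fin 4) :
    ∃ s : ℂ, (s = 1 ∨ s = -1) ∧ pauli1 a * pauli1 b = s • (pauli1 b * pauli1 a) := by
  fin_cases a <;> fin_cases b <;>
    first
    | (refine ⟨1, Or.inl rfl, ?_⟩; simp [pauli1]; done)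
    | (refine ⟨-1, Or.inr rfl, ?_⟩; simp [pauli1])

section IsPauli

variable {n : ℕ} {A B : Matrix (Fin n → Fin 2) (Fin n → Fin 2) ℂ}

theorem IsPauli.exists_mul_eq_smul (hA : IsPauli A) (hB : IsPauli B) :
    ∃ (c : ℂ) (R : Matrix (Fin n → Fin 2) (Fin n → Fin 2) ℂ),
      ‖c‖ = 1 ∧ IsPauli R ∧ A * B = c • R := by
  obtain ⟨f, rfl⟩ := hA
  obtain ⟨g, rfl⟩ := hB
  choose c d hc hd using exists_pauli1_mul
  refine ⟨∏ i, c (f i) (g i), PauliString n fun i => d (f i) (g i), ?_, ⟨_, rfl⟩, ?_⟩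
  · simp [norm_prod, hc]
  · ext x y
    rw [PauliString_mul_apply]
    simp [hd, PauliString, Finset.prod_mul_distrib]

theorem IsPauli.comm_or_antiComm (hA : IsPauli A) (hB : IsPauli B) :
    MComm A B ∨ MAntiComm A B := by
  obtain ⟨f, rfl⟩ := hA
  obtain ⟨g, rfl⟩ := hB
  choose s hs hmul using exists_pauli1_mul_comm
  have key : PauliString n f * PauliString n g =
      (∏ i, s (f i) (g i)) • (PauliString n g * PauliString n f) := by
    ext x y
    rw [Matrix.smul_apply, PauliString_mul_apply, PauliString_mul_apply]
    simp [hmul (f _), Finset.prod_mul_distrib]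
  have hsign : (∏ i, s (f i) (g i)) = 1 ∨ (∏ i, s (f i) (g i)) = -1 :=
    Finset.prod_induction _ (fun z : ℂ => z = 1 ∨ z = -1)
      (by rintro _ _ (rfl | rfl) (rfl | rfl) <;> simp) (Or.inl rfl) fun i _ => hs _ _
  rcases hsign with h | h
  · exact Or.inl (by simpa [h, MComm] using key)
  · exact Or.inr (by simpa [h, MAntiComm] using key)

theorem IsPauli.not_antiComm_of_comm (hA : IsPauli A) (hB : IsPauli B) (h : MComm A B) :
    ¬MAntiComm A B := by
  intro h'
  obtain ⟨f, rfl⟩ := hA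
  obtain ⟨g, rfl⟩ := hB
  have hzero : PauliString n f * PauliString n g = 0 := by
    have hneg : PauliString n f * PauliString n g = -(PauliString n f * PauliString n g) :=
      h'.trans (congrArg Neg.neg (Eq.symm h))
    ext x y
    exact self_eq_neg.mp (congrFun (congrFun hneg x) y)
  have : (1 : Matrix (Fin n → Fin 2) (Fin n → Fin 2) ℂ) = 0 := by
    calc (1 : Matrix (Fin n → Fin 2) (Fin n → Fin 2) ℂ)
        = PauliString n f * (PauliString n f * PauliString n g) * PauliString n g := by
          rw [← mul_assoc, PauliString_mul_self, one_mul, PauliString_mul_self]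
      _ = 0 := by rw [hzero, mul_zero, zero_mul]
  exact one_ne_zero this

end IsPauli

section Commutation

variable {n : ℕ} {A B R X : Matrix (Fin n → Fin 2) (Fin n → Fin 2) ℂ}

theorem MAntiComm.symm (h : MAntiComm A B) : MAntiComm B A := by
  unfold MAntiComm at *
  rw [h, neg_neg]

theorem MComm.symm (h : MComm A B) : MComm B A := Eq.symm h

theorem MAntiComm.of_smul_right {c : ℂ} (hc : c ≠ 0) (h : MAntiComm X (c • R)) :
    MAntiComm X R := by
  unfold MAntiComm at *
  rw [Matrix.mul_smul, Matrix.smul_mul, ← smul_neg] at h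
  exact smul_right_injective _ hc h

theorem MAntiComm.mul_comm_right (hA : MAntiComm X A) (hB : MComm X B) :
    MAntiComm X (A * B) := by
  unfold MAntiComm MComm at *
  rw [← mul_assoc, hA, neg_mul, mul_assoc, hB, mul_assoc]

theorem MComm.mul_antiComm_right (hA : MComm X A) (hB : MAntiComm X B) :
    MAntiComm X (A * B) := by
  unfold MAntiComm MComm at *
  rw [← mul_assoc, hA, mul_assoc, hB, mul_neg, mul_assoc]

end Commutation

section LieClosed

variable {n : ℕ} {𝒢 : Set (Matrix (Fin n → Fin 2) (Fin n → Fin 2) ℂ)}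
  {A B M : Matrix (Fin n → Fin 2) (Fin n → Fin 2) ℂ}

/-- In a Lie-closed set, the product of two anticommuting members is represented by a member
which anticommutes with everything that anticommutes with the product. -/
theorem LieClosed.exists_product (hLie : LieClosed 𝒢) (hPauli : ∀ A ∈ 𝒢, IsPauli A)
    (hA : A ∈ 𝒢) (hB : B ∈ 𝒢) (hAB : MAntiComm A B) :
    ∃ R ∈ 𝒢, ∀ X, MAntiComm X (A * B) → MAntiComm X R := by
  obtain ⟨c, R, hc, hR, hmul⟩ := (hPauli A hA).exists_mul_eq_smul (hPauli B hB)
  have hc0 : c ≠ 0 := norm_ne_zero_iff.mp (by simp [hc])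
  exact ⟨R, hLie A hA B hB hAB c R hc hR hmul, fun X hX => (hmul ▸ hX).of_smul_right hc0⟩

/-- A chain of anticommutations through a Lie-closed set between two commuting Pauli strings
can be shortened to a single intermediate element. -/
theorem LieClosed.exists_antiComm_of_isChain (hLie : LieClosed 𝒢)
    (hPauli : ∀ A ∈ 𝒢, IsPauli A) (hM : IsPauli M)
    (l : List (Matrix (Fin n → Fin 2) (Fin n → Fin 2) ℂ)) (hl : ∀ R ∈ l, R ∈ 𝒢)
    (hA : A ∈ 𝒢) (hAM : MComm A M) (hchain : List.IsChain MAntiComm (A :: (l ++ [M]))) :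
    ∃ R ∈ 𝒢, MAntiComm A R ∧ MAntiComm M R := by
  induction l generalizing A with
  | nil =>
    have : MAntiComm A M := by simpa using hchain
    exact absurd this ((hPauli A hA).not_antiComm_of_comm hM hAM)
  | cons B l ih =>
    rw [List.cons_append, List.isChain_cons_cons] at hchain
    obtain ⟨hAB, hchain⟩ := hchain
    have hB : B ∈ 𝒢 := hl B (by simp)
    rcases (hPauli B hB).comm_or_antiComm hM with hBM | hBM
    · obtain ⟨C, hC, hBC, hMC⟩ := ih (fun R hR => hl R (by simp [hR])) hB hBM hchain
      rcases (hPauli A hA).comm_or_antiComm (hPauli C hC) with hAC | hAC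
      · obtain ⟨R, hR, hprod⟩ := hLie.exists_product hPauli hB hC hBC
        exact ⟨R, hR, hprod A (hAB.mul_comm_right hAC),
          hprod M (hBM.symm.mul_antiComm_right hMC)⟩
      · exact ⟨C, hC, hAC, hMC⟩
    · exact ⟨B, hB, hAB, hBM.symm⟩

end LieClosed

/-- **Lemma 8.** Let `P, Q ∈ 𝒢` anticommute and let `M` be a Pauli
string `𝔤`-connected to `Q`. Then, according to the commutation pattern of `P, Q`
with `M`, there exists `R ∈ 𝒢` with the indicated commutation pattern with
`P`, `Q`, and `M`. -/
theorem exists_R_of_anticommuting_pair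
    {n : ℕ} (hn : 1 ≤ n)
    (𝒢 : Set (Matrix (Fin n → Fin 2) (Fin n → Fin 2) ℂ))
    (h𝒢pauli : ∀ A ∈ 𝒢, IsPauli A) (h𝒢lie : LieClosed 𝒢)
    (P Q M : Matrix (Fin n → Fin 2) (Fin n → Fin 2) ℂ)
    (hP : P ∈ 𝒢) (hQ : Q ∈ 𝒢) (hM : IsPauli M)
    (hPQ : MAntiComm P Q)
    (hconnQM : GConnected 𝒢 Q M) :
    ((MAntiComm P M ∧ MComm Q M) →
        ∃ R ∈ 𝒢, MComm P R ∧ MAntiComm Q R ∧ MAntiComm M R) ∧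
    ((MComm P M ∧ MAntiComm Q M) →
        ∃ R ∈ 𝒢, MAntiComm P R ∧ MComm Q R ∧ MAntiComm M R) ∧
    ((MComm P M ∧ MComm Q M) →
        ∃ R ∈ 𝒢, MAntiComm P R ∧ MAntiComm Q R ∧ MAntiComm M R) := by
  obtain ⟨-, l, hl, hchain⟩ := hconnQM
  refine ⟨fun ⟨hPM, _⟩ => ⟨P, hP, rfl, hPQ.symm, hPM.symm⟩,
    fun ⟨_, hQM⟩ => ⟨Q, hQ, hPQ, rfl, hQM.symm⟩, fun ⟨hPM, hQM⟩ => ?_⟩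
  obtain ⟨C, hC, hQC, hMC⟩ :=
    h𝒢lie.exists_antiComm_of_isChain h𝒢pauli hM l hl hQ hQM hchain
  rcases (h𝒢pauli P hP).comm_or_antiComm (h𝒢pauli C hC) with hPC | hPC
  · obtain ⟨R, hR, hprod⟩ := h𝒢lie.exists_product h𝒢pauli hQ hC hQC
    have hQQ : MComm Q Q := rfl
    exact ⟨R, hR, hprod P (hPQ.mul_comm_right hPC), hprod Q (hQQ.mul_antiComm_right hQC),
      hprod M (hQM.symm.mul_antiComm_right hMC)⟩
  · exact ⟨C, hC, hPC, hQC, hMC⟩
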